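/- Let 2/3 < γ < 2 and let x be a type II solution of the Wainwright–Hsu system with N₁ > 0 and N₂ = N₃ = 0. If the initial value of Σ₋ is nonzero, then the α-limit set of x is a single point on the Kasner circle lying in K₂ ∪ K₃. If instead Σ₋ ≡ 0, then exactly one of the following holds: x is the fixed point P₁⁺(II); x converges to the fixed point F as τ → −∞; or lim_{τ→−∞} (Ω, Σ₊, N₁)(τ) = (0, −1, 0). -/

import Mathlib

open Real Filter Topology Set

noncomputable section

namespace WainwrightHsu

/-- The deceleration parameter `q` of the Wainwright–Hsu system. -/
def qf (γ O Sp Sm : ℝ) : ℝ := (1/2) * (3*γ - 2) * O + 2 * (Sp^2 + Sm^2)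

/-- The curvature term `S₊`. -/
def SPf (n1 n2 n3 : ℝ) : ℝ := (1/2) * ((n2 - n3)^2 - n1 * (2*n1 - n2 - n3))

/-- The curvature term `S₋`. -/
def SMf (n1 n2 n3 : ℝ) : ℝ := (Real.sqrt 3 / 2) * (n3 - n2) * (n1 - n2 - n3)

/-- The Hamiltonian constraint. -/
def Constraint (O Sp Sm n1 n2 n3 : ℝ) : Prop :=
  O + Sp^2 + Sm^2 + (3/4) * (n1^2 + n2^2 + n3^2 - 2*(n1*n2 + n2*n3 + n3*n1)) = 1

/-- `(O, Sp, Sm, n1, n2, n3)` is a solution of the Wainwright–Hsu system (with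
parameter `γ`) on the set `s ⊆ ℝ`, satisfying `Ω ≥ 0` and the constraint. -/
structure SolOn (γ : ℝ) (s : Set ℝ) (O Sp Sm n1 n2 n3 : ℝ → ℝ) : Prop where
  hn1 : ∀ τ ∈ s, HasDerivAt n1 ((qf γ (O τ) (Sp τ) (Sm τ) - 4 * Sp τ) * n1 τ) τ
  hn2 : ∀ τ ∈ s, HasDerivAt n2
    ((qf γ (O τ) (Sp τ) (Sm τ) + 2 * Sp τ + 2 * Real.sqrt 3 * Sm τ) * n2 τ) τ
  hn3 : ∀ τ ∈ s, HasDerivAt n3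
    ((qf γ (O τ) (Sp τ) (Sm τ) + 2 * Sp τ - 2 * Real.sqrt 3 * Sm τ) * n3 τ) τ
  hSp : ∀ τ ∈ s, HasDerivAt Sp
    (-(2 - qf γ (O τ) (Sp τ) (Sm τ)) * Sp τ - 3 * SPf (n1 τ) (n2 τ) (n3 τ)) τ
  hSm : ∀ τ ∈ s, HasDerivAt Sm
    (-(2 - qf γ (O τ) (Sp τ) (Sm τ)) * Sm τ - 3 * SMf (n1 τ) (n2 τ) (n3 τ)) τ
  hO : ∀ τ ∈ s, HasDerivAt O ((2 * qf γ (O τ) (Sp τ) (Sm τ) - (3*γ - 2)) * O τ) τ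
  hOnn : ∀ τ ∈ s, 0 ≤ O τ
  hcon : ∀ τ ∈ s, Constraint (O τ) (Sp τ) (Sm τ) (n1 τ) (n2 τ) (n3 τ)

/-- The solution is of Taub type. -/
def TaubType (s : Set ℝ) (Sp Sm n1 n2 n3 : ℝ → ℝ) : Prop :=
  (∀ τ ∈ s, Sm τ = 0 ∧ n2 τ = n3 τ) ∨
  (∀ τ ∈ s, Sm τ = -(Real.sqrt 3) * Sp τ ∧ n1 τ = n2 τ) ∨
  (∀ τ ∈ s, Sm τ = Real.sqrt 3 * Sp τ ∧ n3 τ = n1 τ)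

/-- The solution converges to the fixed point `F` as `τ → -∞`. -/
def TendstoF (O Sp Sm n1 n2 n3 : ℝ → ℝ) : Prop :=
  Tendsto O atBot (𝓝 1) ∧ Tendsto Sp atBot (𝓝 0) ∧ Tendsto Sm atBot (𝓝 0) ∧
  Tendsto n1 atBot (𝓝 0) ∧ Tendsto n2 atBot (𝓝 0) ∧ Tendsto n3 atBot (𝓝 0)

/-- The solution converges to the fixed point `P₁⁺(II)` as `τ → -∞`. -/
def TendstoP1 (γ : ℝ) (O Sp Sm n1 n2 n3 : ℝ → ℝ) : Prop :=
  Tendsto O atBot (𝓝 (1 - (3*γ - 2)/16)) ∧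
  Tendsto Sp atBot (𝓝 ((3*γ - 2)/8)) ∧ Tendsto Sm atBot (𝓝 0) ∧
  (∃ c : ℝ, 0 < c ∧ Tendsto n1 atBot (𝓝 c)) ∧
  Tendsto n2 atBot (𝓝 0) ∧ Tendsto n3 atBot (𝓝 0)

/-- The solution converges to the fixed point `P₂⁺(II)` as `τ → -∞`. -/
def TendstoP2 (γ : ℝ) (O Sp Sm n1 n2 n3 : ℝ → ℝ) : Prop :=
  Tendsto O atBot (𝓝 (1 - (3*γ - 2)/16)) ∧
  Tendsto Sp atBot (𝓝 (-((3*γ - 2)/16))) ∧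
  Tendsto Sm atBot (𝓝 (-(Real.sqrt 3 * (3*γ - 2)/16))) ∧
  Tendsto n1 atBot (𝓝 0) ∧
  (∃ c : ℝ, 0 < c ∧ Tendsto n2 atBot (𝓝 c)) ∧ Tendsto n3 atBot (𝓝 0)

/-- The solution converges to the fixed point `P₃⁺(II)` as `τ → -∞`. -/
def TendstoP3 (γ : ℝ) (O Sp Sm n1 n2 n3 : ℝ → ℝ) : Prop :=
  Tendsto O atBot (𝓝 (1 - (3*γ - 2)/16)) ∧
  Tendsto Sp atBot (𝓝 (-((3*γ - 2)/16))) ∧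
  Tendsto Sm atBot (𝓝 (Real.sqrt 3 * (3*γ - 2)/16)) ∧
  Tendsto n1 atBot (𝓝 0) ∧ Tendsto n2 atBot (𝓝 0) ∧
  (∃ c : ℝ, 0 < c ∧ Tendsto n3 atBot (𝓝 c))

/-- A Bianchi IX solution is generic if it is not of Taub type and does not
converge to `F` nor to any of the `Pᵢ⁺(II)` as `τ → -∞`. -/
def Generic (γ : ℝ) (s : Set ℝ) (O Sp Sm n1 n2 n3 : ℝ → ℝ) : Prop :=
  ¬ TaubType s Sp Sm n1 n2 n3 ∧ ¬ TendstoF O Sp Sm n1 n2 n3 ∧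
  ¬ TendstoP1 γ O Sp Sm n1 n2 n3 ∧ ¬ TendstoP2 γ O Sp Sm n1 n2 n3 ∧
  ¬ TendstoP3 γ O Sp Sm n1 n2 n3

/-- `(a, b, c, d, e, f)` is an α-limit point of the solution:
some sequence of times tending to `-∞` along which the solution converges to it. -/
def AlphaLim (O Sp Sm n1 n2 n3 : ℝ → ℝ) (a b c d e f : ℝ) : Prop :=
  ∃ τs : ℕ → ℝ, Tendsto τs atTop atBot ∧
    Tendsto (fun k => O (τs k)) atTop (𝓝 a) ∧
    Tendsto (fun k => Sp (τs k)) atTop (𝓝 b) ∧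
    Tendsto (fun k => Sm (τs k)) atTop (𝓝 c) ∧
    Tendsto (fun k => n1 (τs k)) atTop (𝓝 d) ∧
    Tendsto (fun k => n2 (τs k)) atTop (𝓝 e) ∧
    Tendsto (fun k => n3 (τs k)) atTop (𝓝 f)

/-- ω-limit point (times tending to `+∞`). -/
def OmegaLim (O Sp Sm n1 n2 n3 : ℝ → ℝ) (a b c d e f : ℝ) : Prop :=
  ∃ τs : ℕ → ℝ, Tendsto τs atTop atTop ∧
    Tendsto (fun k => O (τs k)) atTop (𝓝 a) ∧
    Tendsto (fun k => Sp (τs k)) atTop (𝓝 b) ∧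
    Tendsto (fun k => Sm (τs k)) atTop (𝓝 c) ∧
    Tendsto (fun k => n1 (τs k)) atTop (𝓝 d) ∧
    Tendsto (fun k => n2 (τs k)) atTop (𝓝 e) ∧
    Tendsto (fun k => n3 (τs k)) atTop (𝓝 f)

/-- α-limit point, phrased for a point of `ℝ⁶` (in coordinates `Ω, Σ₊, Σ₋, N₁, N₂, N₃`). -/
def AlphaLimPt (O Sp Sm n1 n2 n3 : ℝ → ℝ) (p : Fin 6 → ℝ) : Prop :=
  ∃ τs : ℕ → ℝ, Tendsto τs atTop atBot ∧
    Tendsto (fun k =>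
      (![O (τs k), Sp (τs k), Sm (τs k), n1 (τs k), n2 (τs k), n3 (τs k)] : Fin 6 → ℝ))
      atTop (𝓝 p)

/-- A non-special point of the Kasner circle, given by its `(Σ₊, Σ₋)` coordinates. -/
def NonSpecialKasner (a b : ℝ) : Prop :=
  a^2 + b^2 = 1 ∧ (a, b) ≠ (-1, 0) ∧
  (a, b) ≠ (1/2, Real.sqrt 3 / 2) ∧ (a, b) ≠ (1/2, -(Real.sqrt 3) / 2)

/-- The state vector of a solution, as a point of Euclidean `ℝ⁶`. -/
def stateVec (O Sp Sm n1 n2 n3 : ℝ → ℝ) (τ : ℝ) : EuclideanSpace ℝ (Fin 6) :=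
  (WithLp.equiv 2 (Fin 6 → ℝ)).symm ![O τ, Sp τ, Sm τ, n1 τ, n2 τ, n3 τ]

/-- The Bianchi attractor `𝒜`: the closure of the vacuum type I and II points, i.e. the
points of `ℝ⁶` satisfying the constraint with `Ω = 0` and `N₁N₂ = N₂N₃ = N₃N₁ = 0`. -/
def attractor : Set (EuclideanSpace ℝ (Fin 6)) :=
  {y | Constraint (y 0) (y 1) (y 2) (y 3) (y 4) (y 5) ∧
    y 0 = 0 ∧ y 3 * y 4 = 0 ∧ y 4 * y 5 = 0 ∧ y 5 * y 3 = 0}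


/-- The solution is identically equal to the fixed point `P₁⁺(II)` on `s`. -/
def IsFixedP1 (γ : ℝ) (s : Set ℝ) (O Sp Sm n1 n2 n3 : ℝ → ℝ) : Prop :=
  ∀ τ ∈ s, O τ = 1 - (3*γ - 2)/16 ∧ Sp τ = (3*γ - 2)/8 ∧ Sm τ = 0 ∧
    0 < n1 τ ∧ n2 τ = 0 ∧ n3 τ = 0


lemma mono_of {f f' : ℝ → ℝ} {T : ℝ} (hd : ∀ τ ≤ T, HasDerivAt f (f' τ) τ)
    (hp : ∀ τ ≤ T, 0 ≤ f' τ) : MonotoneOn f (Iic T) := by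
  apply monotoneOn_of_deriv_nonneg (convex_Iic T)
  · intro τ hτ
    exact (hd τ hτ).continuousAt.continuousWithinAt
  · intro τ hτ
    have h : τ ∈ Iic T := interior_subset hτ
    exact (hd τ h).differentiableAt.differentiableWithinAt
  · intro τ hτ
    have h : τ ∈ Iic T := interior_subset hτ
    rw [(hd τ h).deriv]
    exact hp τ h

lemma conv_mono {f f' : ℝ → ℝ} {T B : ℝ} (hd : ∀ τ ≤ T, HasDerivAt f (f' τ) τ)
    (hp : ∀ τ ≤ T, 0 ≤ f' τ) (hB : ∀ τ ≤ T, B ≤ f τ) :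
    ∃ l, Tendsto f atBot (𝓝 l) ∧ ∀ τ ≤ T, l ≤ f τ := by
  have hm := mono_of hd hp
  have hg : Monotone (fun τ => f (min τ T)) := by
    intro a b hab
    exact hm (mem_Iic.2 (min_le_right _ _)) (mem_Iic.2 (min_le_right _ _)) (min_le_min_right _ hab)
  have hb : BddBelow (range (fun τ => f (min τ T))) := by
    refine ⟨B, ?_⟩
    rintro _ ⟨τ, rfl⟩
    exact hB _ (min_le_right _ _)
  have ht := tendsto_atBot_ciInf hg hb
  refine ⟨_, ht.congr' ?_, ?_⟩
  · filter_upwards [eventually_le_atBot T] with τ hτ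
    simp [min_eq_left hτ]
  · intro τ hτ
    have := ciInf_le hb τ
    simpa [min_eq_left hτ] using this

lemma mvt1 {f f' : ℝ → ℝ} {T : ℝ} (hd : ∀ τ ≤ T, HasDerivAt f (f' τ) τ)
    {a b : ℝ} (hab : a < b) (hb : b ≤ T) :
    ∃ c, a < c ∧ c < b ∧ f b - f a = f' c * (b - a) := by
  obtain ⟨c, hc, h⟩ := exists_hasDerivAt_eq_slope f f' hab
    (fun t ht => (hd t (ht.2.trans hb)).continuousAt.continuousWithinAt)
    (fun t ht => hd t (ht.2.le.trans hb))
  refine ⟨c, hc.1, hc.2, ?_⟩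
  rw [h]
  have : b - a ≠ 0 := by linarith
  field_simp

lemma diff_small {f : ℝ → ℝ} {l : ℝ} (hf : Tendsto f atBot (𝓝 l)) {e : ℝ} (he : 0 < e) :
    ∃ T, ∀ a ≤ T, ∀ b ≤ T, |f b - f a| < e := by
  have := (Metric.tendsto_nhds.1 hf) (e/2) (by linarith)
  obtain ⟨T, hT⟩ := eventually_atBot.1 this
  refine ⟨T, fun a ha b hb => ?_⟩
  have h1 := hT a ha
  have h2 := hT b hb
  rw [Real.dist_eq, abs_lt] at h1 h2
  rw [abs_lt]
  constructor <;> linarith [h1.1, h1.2, h2.1, h2.2]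

lemma deriv_lim_zero {f f' : ℝ → ℝ} {T l L : ℝ} (hd : ∀ τ ≤ T, HasDerivAt f (f' τ) τ)
    (hf : Tendsto f atBot (𝓝 l)) (hf' : Tendsto f' atBot (𝓝 L)) : L = 0 := by
  by_contra hL
  have hL' : 0 < |L| := abs_pos.2 hL
  obtain ⟨T1, hT1⟩ := diff_small hf (half_pos hL')
  obtain ⟨T2, hT2⟩ := eventually_atBot.1 ((Metric.tendsto_nhds.1 hf') (|L|/2) (half_pos hL'))
  set s := min T (min T1 T2) with hs
  have h1 : s ≤ T := min_le_left _ _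
  have h2 : s ≤ T1 := (min_le_right _ _).trans (min_le_left _ _)
  have h3 : s ≤ T2 := (min_le_right _ _).trans (min_le_right _ _)
  obtain ⟨c, hc1, hc2, hc⟩ := mvt1 hd (show s - 1 < s by linarith) h1
  have h4 := hT1 (s-1) (by linarith) s h2
  have h5 := hT2 c (by linarith)
  rw [hc] at h4
  rw [Real.dist_eq] at h5
  have h6 : f' c * (s - (s-1)) = f' c := by ring
  rw [h6] at h4
  have := abs_sub_abs_le_abs_sub L (f' c)
  rw [abs_sub_comm] at this
  linarith

lemma barbalat {f g h : ℝ → ℝ} {T l K : ℝ} (hd : ∀ τ ≤ T, HasDerivAt f (g τ) τ)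
    (hg : ∀ τ ≤ T, HasDerivAt g (h τ) τ) (hK : ∀ τ ≤ T, |h τ| ≤ K)
    (hf : Tendsto f atBot (𝓝 l)) : Tendsto g atBot (𝓝 0) := by
  have hK0 : 0 ≤ K := (abs_nonneg _).trans (hK T le_rfl)
  rw [Metric.tendsto_nhds]
  intro e he
  -- step size d with K d ≤ e/2
  set d := e / (2 * (K + 1)) with hdd
  have hd0 : 0 < d := by positivity
  have hKd : K * d ≤ e / 2 := by
    have : (K + 1) * d = e / 2 := by rw [hdd]; field_simp
    nlinarith
  obtain ⟨T1, hT1⟩ := diff_small hf (show 0 < d * (e/2) by positivity)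
  filter_upwards [eventually_le_atBot T, eventually_le_atBot T1] with τ h1 h2
  obtain ⟨c, hc1, hc2, hc⟩ := mvt1 hd (show τ - d < τ by linarith) h1
  have h3 := hT1 (τ - d) (by linarith) τ h2
  have h4 : f τ - f (τ - d) = g c * d := by rw [hc]; ring
  rw [h4, abs_mul, abs_of_pos hd0] at h3
  have h5 : |g c| < e / 2 := by nlinarith
  obtain ⟨c2, hc21, hc22, hc2'⟩ := mvt1 hg hc2 h1
  have h6 : |g τ - g c| ≤ e / 2 := by
    rw [hc2', abs_mul, abs_of_pos (show 0 < τ - c by linarith)]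
    have := hK c2 (by linarith)
    calc |h c2| * (τ - c) ≤ K * d := by
          apply mul_le_mul this (by linarith) (by linarith) hK0
      _ ≤ _ := hKd
  rw [Real.dist_eq, sub_zero]
  have := abs_sub_abs_le_abs_sub (g τ) (g c)
  linarith

lemma no_decay {f f' : ℝ → ℝ} {T : ℝ} (hd : ∀ τ ≤ T, HasDerivAt f (f' τ) τ)
    (hp : ∀ τ ≤ T, f' τ ≤ 0) (hpos : 0 < f T) (hf : Tendsto f atBot (𝓝 0)) : False := by
  have hm := mono_of (f := fun t => - f t) (f' := fun t => - f' t) (T := T)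
    (fun τ h => (hd τ h).neg) (fun τ h => by linarith [hp τ h])
  have : f T ≤ 0 := by
    refine ge_of_tendsto hf ?_
    filter_upwards [eventually_le_atBot T] with τ hτ
    have := hm (show τ ∈ Iic T from hτ) (mem_Iic.2 le_rfl) hτ
    simpa using this
  linarith

lemma no_growth {f f' : ℝ → ℝ} {T δ B : ℝ} (hδ : 0 < δ) (hd : ∀ τ ≤ T, HasDerivAt f (f' τ) τ)
    (hp : ∀ τ ≤ T, δ ≤ f' τ) (hB : ∀ τ ≤ T, B ≤ f τ) : False := by
  have h0 : 0 ≤ f T - B := by linarith [hB T le_rfl]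
  have hs : 0 < (f T - B) / δ + 1 := by positivity
  obtain ⟨c, hc1, hc2, hc⟩ := mvt1 hd (show T - ((f T - B) / δ + 1) < T by linarith) le_rfl
  have h1 := hp c hc2.le
  have h2 := hB (T - ((f T - B) / δ + 1)) (by linarith)
  have h3 : δ * ((f T - B) / δ + 1) = f T - B + δ := by field_simp
  have h4 : δ * ((f T - B) / δ + 1) ≤ f' c * ((f T - B) / δ + 1) :=
    mul_le_mul_of_nonneg_right h1 hs.le
  have h5 : T - (T - ((f T - B) / δ + 1)) = (f T - B) / δ + 1 := by ring
  rw [h5] at hc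
  linarith

lemma back_barrier {f : ℝ → ℝ} {τ0 : ℝ} (hc : ContinuousOn f (Iic τ0)) (h0 : f τ0 ≤ 0)
    (hstep : ∀ t ≤ τ0, f t ≤ 0 → ∀ᶠ s in 𝓝[<] t, f s ≤ 0) : ∀ t ≤ τ0, f t ≤ 0 := by
  intro t ht
  have hcont : ContinuousOn (fun u => f (-u)) (Icc (-τ0) (-t)) := by
    apply hc.comp continuous_neg.continuousOn
    intro u hu
    have := hu.1
    simp only [mem_Iic]; linarith
  have hcl : IsClosed ({u | f (-u) ≤ 0} ∩ Icc (-τ0) (-t)) := by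
    have := hcont.preimage_isClosed_of_isClosed isClosed_Icc (isClosed_Iic (a := (0:ℝ)))
    rw [inter_comm]; exact this
  have key := hcl.Icc_subset_of_forall_mem_nhdsWithin (by simpa using h0) (by
    rintro u ⟨hu, hu1, hu2⟩
    have h1 := hstep (-u) (by linarith) hu
    have h2 : Tendsto (fun w : ℝ => -w) (𝓝[>] u) (𝓝[<] (-u)) := by
      exact tendsto_neg_nhdsGT
    exact h2.eventually h1)
  have := key (show -t ∈ Icc (-τ0) (-t) from ⟨by linarith, le_rfl⟩)
  simpa using this

lemma left_lt {f : ℝ → ℝ} {d t : ℝ} (hd : HasDerivAt f d t) (hp : 0 < d) :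
    ∀ᶠ s in 𝓝[<] t, f s < f t := by
  have h := (hasDerivAt_iff_tendsto_slope.1 hd).eventually (eventually_gt_nhds hp)
  have h2 : ∀ᶠ s in 𝓝[<] t, 0 < slope f t s :=
    h.filter_mono (nhdsWithin_mono _ (fun s hs => ne_of_lt hs))
  filter_upwards [h2, self_mem_nhdsWithin] with s hs hst
  rw [slope_def_field] at hs
  have hst : s - t < 0 := sub_neg.2 hst
  rcases div_pos_iff.1 hs with h | h <;> linarith [h.1, h.2]

/-- The reduced system for `Σ₋ = 0`, with `x = Σ₊`, `r = N₁²`, `v = (3γ-2)/8`. -/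
structure Sys (v : ℝ) (x r O : ℝ → ℝ) : Prop where
  v0 : 0 < v
  v1 : v < 1/2
  hx : ∀ τ ≤ 0, HasDerivAt x (3/2 * r τ * (2 - x τ) - (2 - 4*v) * O τ * x τ) τ
  hr : ∀ τ ≤ 0, HasDerivAt r ((8*v*O τ + 4*x τ^2 - 8*x τ) * r τ) τ
  hO : ∀ τ ≤ 0, HasDerivAt O ((8*v*O τ + 4*x τ^2 - 8*v) * O τ) τ
  rpos : ∀ τ ≤ 0, 0 < r τ
  Onn : ∀ τ ≤ 0, 0 ≤ O τ
  con : ∀ τ ≤ 0, O τ + x τ^2 + 3/4 * r τ = 1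

namespace Sys
variable {v : ℝ} {x r O : ℝ → ℝ}

lemma xbd (h : Sys v x r O) {τ : ℝ} (hτ : τ ≤ 0) : -1 < x τ ∧ x τ < 1 := by
  have h1 := h.rpos τ hτ
  have h2 := h.Onn τ hτ
  have h3 := h.con τ hτ
  constructor <;> nlinarith

lemma hR (h : Sys v x r O) : ∀ τ ≤ 0,
    HasDerivAt (fun t => O t / r t) (8 * (x τ - v) * (O τ / r τ)) τ := by
  intro τ hτ
  have h1 := (h.rpos τ hτ).ne'
  refine ((h.hO τ hτ).div (h.hr τ hτ) h1).congr_deriv ?_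
  field_simp
  ring

/-- If `Ω → 0`, `x → 1`, `r → 0` we get a contradiction. -/
lemma not_one (h : Sys v x r O) (hO : Tendsto O atBot (𝓝 0)) (hx : Tendsto x atBot (𝓝 1))
    (hr : Tendsto r atBot (𝓝 0)) : False := by
  have ht : Tendsto (fun τ => 8*v*O τ + 4*x τ^2 - 8*x τ) atBot (𝓝 (8*v*0+4*1^2-8*1)) :=
    ((hO.const_mul (8*v)).add ((hx.pow 2).const_mul 4)).sub (hx.const_mul 8)
  have he := ht.eventually (eventually_lt_nhds (show 8*v*0+4*1^2-8*1 < (0:ℝ) by norm_num))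
  obtain ⟨T, hT⟩ := eventually_atBot.1 he
  refine no_decay (f := r) (T := min T 0) (fun τ hτ => h.hr τ (hτ.trans (min_le_right _ _)))
    (fun τ hτ => ?_) (h.rpos _ (min_le_right _ _)) hr
  have h1 := hT τ (hτ.trans (min_le_left _ _))
  have h2 := h.rpos τ (hτ.trans (min_le_right _ _))
  nlinarith

lemma tendsto_xd (_h : Sys v x r O) {a o ρ : ℝ} (hO : Tendsto O atBot (𝓝 o))
    (hx : Tendsto x atBot (𝓝 a)) (hr : Tendsto r atBot (𝓝 ρ)) :
    Tendsto (fun τ => 3/2 * r τ * (2 - x τ) - (2 - 4*v) * O τ * x τ) atBot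
      (𝓝 (3/2 * ρ * (2 - a) - (2 - 4*v) * o * a)) :=
  ((hr.const_mul _).mul (hx.const_sub 2)).sub ((hO.const_mul _).mul hx)

/-- Lemma A -/
lemma lemA (h : Sys v x r O) (hR0 : Tendsto (fun t => O t / r t) atBot (𝓝 0)) :
    Tendsto O atBot (𝓝 0) ∧ Tendsto x atBot (𝓝 (-1)) ∧ Tendsto r atBot (𝓝 0) := by
  have v0 := h.v0
  have v1 := h.v1
  obtain ⟨T', hT'⟩ := eventually_atBot.1 (hR0.eventually (eventually_lt_nhds
    (show (0:ℝ) < 1/2 by norm_num)))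
  set T := min T' 0
  have hT0 : T ≤ 0 := min_le_right _ _
  have hT : ∀ τ ≤ T, O τ ≤ 1/2 * r τ := by
    intro τ hτ
    have h1 := hT' τ (hτ.trans (min_le_left _ _))
    rw [div_lt_iff₀ (h.rpos τ (hτ.trans hT0))] at h1
    exact h1.le
  obtain ⟨a, ha, -⟩ := conv_mono (f := x) (T := T) (B := -1) (fun τ hτ => h.hx τ (hτ.trans hT0))
    (by
      intro τ hτ
      have h1 := hT τ hτ
      obtain ⟨h2, h3⟩ := h.xbd (hτ.trans hT0)
      have h4 := h.rpos τ (hτ.trans hT0)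
      have h5 := h.Onn τ (hτ.trans hT0)
      have h6 : (2 - 4*v) * O τ * x τ ≤ 2 * (1/2 * r τ) := by
        have e1 : (2 - 4*v) * O τ ≤ 2 * (1/2 * r τ) := by nlinarith
        have e2 : 0 ≤ (2 - 4*v) * O τ := mul_nonneg (by linarith) h5
        nlinarith
      nlinarith)
    (fun τ hτ => (h.xbd (hτ.trans hT0)).1.le)
  have hr : Tendsto r atBot (𝓝 ((1 - a^2) / (0 + 3/4))) := by
    refine Tendsto.congr' ?_ (((ha.pow 2).const_sub 1).div (hR0.add_const (3/4)) (by norm_num))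
    filter_upwards [eventually_le_atBot 0] with τ hτ
    have h1 := h.con τ hτ
    have h2 := h.rpos τ hτ
    have h3 := h.Onn τ hτ
    simp only [Pi.div_apply]
    rw [div_eq_iff (by positivity)]
    field_simp
    linarith
  have hO : Tendsto O atBot (𝓝 (0 * ((1 - a^2) / (0 + 3/4)))) := by
    refine Tendsto.congr' ?_ (hR0.mul hr)
    filter_upwards [eventually_le_atBot 0] with τ hτ
    have h2 := (h.rpos τ hτ).ne'
    field_simp
  rw [zero_mul] at hO
  have hz := deriv_lim_zero h.hx ha (h.tendsto_xd hO ha hr)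
  have hab : -1 ≤ a ∧ a ≤ 1 := by
    constructor
    · refine ge_of_tendsto ha ?_
      filter_upwards [eventually_le_atBot 0] with τ hτ using (h.xbd hτ).1.le
    · refine le_of_tendsto ha ?_
      filter_upwards [eventually_le_atBot 0] with τ hτ using (h.xbd hτ).2.le
  have hz2 : (1 - a) * ((1 + a) * (2 - a)) = 0 := by
    norm_num at hz
    rcases hz with hz | hz
    · rw [← mul_assoc, show (1 - a) * (1 + a) = 1 - a^2 by ring, hz, zero_mul]
    · rw [hz]; ring
  rcases mul_eq_zero.1 hz2 with h1 | h1
  · exfalso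
    have : a = 1 := by linarith
    subst this
    norm_num at hr
    exact h.not_one hO ha hr
  · rcases mul_eq_zero.1 h1 with h1 | h1
    · have : a = -1 := by linarith
      subst this
      norm_num at hr
      exact ⟨hO, ha, hr⟩
    · linarith

/-- Lemma B -/
lemma lemB (h : Sys v x r O) {τ0 : ℝ} (hτ0 : τ0 ≤ 0) (hx0 : x τ0 ≤ 0) :
    (Tendsto O atBot (𝓝 1) ∧ Tendsto x atBot (𝓝 0) ∧ Tendsto r atBot (𝓝 0)) ∨
    (Tendsto O atBot (𝓝 0) ∧ Tendsto x atBot (𝓝 (-1)) ∧ Tendsto r atBot (𝓝 0)) := by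
  have v0 := h.v0
  have v1 := h.v1
  have hneg : ∀ τ ≤ τ0, x τ ≤ 0 := by
    refine back_barrier
      (fun τ hτ => (h.hx τ ((mem_Iic.1 hτ).trans hτ0)).continuousAt.continuousWithinAt) hx0 ?_
    intro t ht hxt
    have ht0 := ht.trans hτ0
    rcases hxt.lt_or_eq with h1 | h1
    · have := (h.hx t ht0).continuousAt.eventually (eventually_lt_nhds h1)
      exact (this.filter_mono nhdsWithin_le_nhds).mono (fun s hs => hs.le)
    · have hp := h.rpos t ht0
      have := left_lt (h.hx t ht0) (by rw [h1]; linarith)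
      rw [h1] at this
      exact this.mono (fun s hs => hs.le)
  obtain ⟨a, ha, -⟩ := conv_mono (f := x) (T := τ0) (B := -1) (fun τ hτ => h.hx τ (hτ.trans hτ0))
    (by
      intro τ hτ
      have h1 := hneg τ hτ
      have h4 := h.rpos τ (hτ.trans hτ0)
      have h5 := h.Onn τ (hτ.trans hτ0)
      have h6 : 0 ≤ (2 - 4*v) * O τ := mul_nonneg (by linarith) h5
      nlinarith)
    (fun τ hτ => (h.xbd (hτ.trans hτ0)).1.le)
  obtain ⟨ρ, hr, -⟩ := conv_mono (f := r) (T := τ0) (B := 0) (fun τ hτ => h.hr τ (hτ.trans hτ0))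
    (by
      intro τ hτ
      have h1 := hneg τ hτ
      have h4 := h.rpos τ (hτ.trans hτ0)
      have h5 := h.Onn τ (hτ.trans hτ0)
      apply mul_nonneg _ h4.le
      have := mul_nonneg v0.le h5
      nlinarith)
    (fun τ hτ => (h.rpos _ (hτ.trans hτ0)).le)
  have hO : Tendsto O atBot (𝓝 (1 - a^2 - 3/4 * ρ)) := by
    refine Tendsto.congr' ?_ (((ha.pow 2).const_sub 1).sub (hr.const_mul (3/4)))
    filter_upwards [eventually_le_atBot 0] with τ hτ
    have h1 := h.con τ hτ
    linarith
  have hz := deriv_lim_zero h.hx ha (h.tendsto_xd hO ha hr)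
  have ha0 : a ≤ 0 := le_of_tendsto ha (by
    filter_upwards [eventually_le_atBot τ0] with τ hτ using hneg τ hτ)
  have hρ0 : 0 ≤ ρ := ge_of_tendsto hr (by
    filter_upwards [eventually_le_atBot 0] with τ hτ using (h.rpos τ hτ).le)
  have ho0 : 0 ≤ 1 - a^2 - 3/4 * ρ := ge_of_tendsto hO (by
    filter_upwards [eventually_le_atBot 0] with τ hτ using h.Onn τ hτ)
  have e1 : 0 ≤ (2 - 4*v) * (1 - a^2 - 3/4 * ρ) * (-a) :=
    mul_nonneg (mul_nonneg (by linarith) ho0) (by linarith)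
  have e2 : ρ = 0 := by nlinarith
  subst e2
  have e3 : (2 - 4 * v) * (a * (1 - a) * (1 + a)) = 0 := by linarith
  rcases mul_eq_zero.1 e3 with e4 | e4
  · linarith
  rcases mul_eq_zero.1 e4 with e4 | e4
  · rcases mul_eq_zero.1 e4 with e4 | e4
    · left; subst e4; norm_num at hO; exact ⟨hO, ha, hr⟩
    · linarith
  · right
    have : a = -1 := by linarith
    subst this
    norm_num at hO
    exact ⟨hO, ha, hr⟩

/-- exponent of the monotone function -/
def mm (v : ℝ) : ℝ := v * (1 - 2*v) / (2 * (1 - v^2))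

/-- logarithm of the monotone function -/
def LL (v : ℝ) (x r O : ℝ → ℝ) (τ : ℝ) : ℝ :=
  mm v * Real.log (r τ) + (1 - mm v) * Real.log (O τ) - 2 * Real.log (1 - v * x τ)

lemma vsq (h : Sys v x r O) : 0 < 1 - v^2 := by nlinarith [h.v0, h.v1]

lemma mm_mul (h : Sys v x r O) : mm v * (1 - v^2) = v * (1 - 2*v) / 2 := by
  have := h.vsq.ne'
  unfold mm
  field_simp

lemma mm_pos (h : Sys v x r O) : 0 < mm v := by
  have := h.vsq
  have h1 := h.v0
  have h2 : 0 < 1 - 2*v := by linarith [h.v1]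
  unfold mm
  positivity

lemma mm_lt (h : Sys v x r O) : mm v < 1 := by
  have := h.vsq
  unfold mm
  rw [div_lt_one (by positivity)]
  nlinarith [h.v0, h.v1]

lemma vx_pos (h : Sys v x r O) {τ : ℝ} (hτ : τ ≤ 0) : 0 < 1 - v * x τ := by
  have := h.xbd hτ
  nlinarith [h.v0, h.v1]

lemma hLL (h : Sys v x r O) (hOp : ∀ τ ≤ 0, 0 < O τ) : ∀ τ ≤ 0,
    HasDerivAt (LL v x r O) (4*(1-2*v)/(1-v^2) * (x τ - v)^2 / (1 - v * x τ)) τ := by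
  intro τ hτ
  have h1 := (h.rpos τ hτ).ne'
  have h2 := (hOp τ hτ).ne'
  have h3 := (h.vx_pos hτ).ne'
  have h4 := h.vsq.ne'
  have hd := ((((h.hr τ hτ).log h1).const_mul (mm v)).add
    (((h.hO τ hτ).log h2).const_mul (1 - mm v))).sub
    ((((h.hx τ hτ).const_mul v).const_sub 1).log h3 |>.const_mul 2)
  refine HasDerivAt.congr_deriv hd ?_
  rw [mul_div_assoc _ (r τ), div_self h1, mul_div_assoc _ (O τ), div_self h2]
  have h5 : r τ = 4/3 * (1 - x τ^2 - O τ) := by linarith [h.con τ hτ]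
  rw [h5]
  generalize x τ = X at *
  generalize O τ = Y at *
  unfold mm
  field_simp
  ring

lemma r_bound (h : Sys v x r O) {τ ρ : ℝ} (hτ : τ ≤ 0) (hρ : 0 < ρ) (hx0 : 0 ≤ x τ)
    (hR : ρ ≤ O τ / r τ) :
    Real.log (r τ) ≤ LL v x r O τ - (1 - mm v) * Real.log ρ := by
  have h1 := h.rpos τ hτ
  have h2 : 0 < O τ := by
    have : 0 < O τ / r τ := hρ.trans_le hR
    exact (div_pos_iff_of_pos_right h1).1 this
  have h3 := Real.log_le_log hρ hR
  rw [Real.log_div h2.ne' h1.ne'] at h3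
  have h4 : Real.log (1 - v * x τ) ≤ 0 := by
    apply Real.log_nonpos (h.vx_pos hτ).le
    have := mul_nonneg h.v0.le hx0
    linarith
  have h5 := mul_le_mul_of_nonneg_left h3 (show 0 ≤ 1 - mm v by linarith [h.mm_lt])
  unfold LL
  linarith

lemma r_zero (h : Sys v x r O) (hL : Tendsto (LL v x r O) atBot atBot) {T ρ : ℝ} (hT : T ≤ 0)
    (hρ : 0 < ρ) (hx0 : ∀ τ ≤ T, 0 ≤ x τ) (hR : ∀ τ ≤ T, ρ ≤ O τ / r τ) :
    Tendsto r atBot (𝓝 0) := by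
  have h1 : Tendsto (fun τ => Real.log (r τ)) atBot atBot := by
    refine tendsto_atBot_mono' _ ?_ (tendsto_atBot_add_const_right _ (-((1 - mm v) * Real.log ρ)) hL)
    filter_upwards [eventually_le_atBot T] with τ hτ
    have := h.r_bound (hτ.trans hT) hρ (hx0 τ hτ) (hR τ hτ)
    linarith
  refine (Real.tendsto_exp_atBot.comp h1).congr' ?_
  filter_upwards [eventually_le_atBot 0] with τ hτ
  exact Real.exp_log (h.rpos τ hτ)

end Sys

lemma sq_zero {f : ℝ → ℝ} (hf : Tendsto (fun t => f t ^ 2) atBot (𝓝 0)) :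
    Tendsto f atBot (𝓝 0) := by
  have h := hf.sqrt
  simp only [Real.sqrt_sq_eq_abs, Real.sqrt_zero] at h
  exact (tendsto_zero_iff_abs_tendsto_zero _).2 h

namespace Sys
variable {v : ℝ} {x r O : ℝ → ℝ}

/-- Lemma C -/
lemma lemC (h : Sys v x r O) (hL : Tendsto (LL v x r O) atBot atBot) {T : ℝ} (hT : T ≤ 0)
    (hx : ∀ τ ≤ T, v ≤ x τ) : False := by
  have v0 := h.v0
  obtain ⟨ρ, hρ, hρle⟩ := conv_mono (f := fun t => O t / r t) (T := T) (B := 0)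
    (fun τ hτ => h.hR τ (hτ.trans hT))
    (fun τ hτ => mul_nonneg (by linarith [hx τ hτ])
      (div_nonneg (h.Onn τ (hτ.trans hT)) (h.rpos τ (hτ.trans hT)).le))
    (fun τ hτ => div_nonneg (h.Onn τ (hτ.trans hT)) (h.rpos τ (hτ.trans hT)).le)
  have hρ0 : 0 ≤ ρ := ge_of_tendsto hρ (by
    filter_upwards [eventually_le_atBot 0] with τ hτ
    exact div_nonneg (h.Onn τ hτ) (h.rpos τ hτ).le)
  rcases hρ0.eq_or_lt with h0 | h0
  · subst h0
    obtain ⟨-, h2, -⟩ := h.lemA hρ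
    have : v ≤ -1 := ge_of_tendsto h2 (by
      filter_upwards [eventually_le_atBot T] with τ hτ using hx τ hτ)
    linarith
  · have hr := h.r_zero hL hT h0 (fun τ hτ => v0.le.trans (hx τ hτ)) hρle
    have hO : Tendsto O atBot (𝓝 (ρ * 0)) := by
      refine Tendsto.congr' ?_ (hρ.mul hr)
      filter_upwards [eventually_le_atBot 0] with τ hτ
      have h2 := (h.rpos τ hτ).ne'
      field_simp
    rw [mul_zero] at hO
    have hx1 : Tendsto x atBot (𝓝 (Real.sqrt (1 - 0 - 3/4 * 0))) := by
      refine Tendsto.congr' ?_ ((hO.const_sub 1).sub (hr.const_mul (3/4))).sqrt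
      filter_upwards [eventually_le_atBot 0, eventually_le_atBot T] with τ hτ hτ'
      have h1 := h.con τ hτ
      have : 1 - O τ - 3/4 * r τ = x τ ^ 2 := by linarith
      rw [this, Real.sqrt_sq (v0.le.trans (hx τ hτ'))]
    norm_num at hx1
    exact h.not_one hO hx1 hr

/-- Lemma E -/
lemma lemE (h : Sys v x r O) (hL : Tendsto (LL v x r O) atBot atBot)
    (hx : ∀ τ ≤ 0, 0 < x τ) :
    Tendsto O atBot (𝓝 1) ∧ Tendsto x atBot (𝓝 0) ∧ Tendsto r atBot (𝓝 0) := by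
  have v0 := h.v0
  have v1 := h.v1
  have hw : 0 < 2 - 4*v := by linarith
  set g : ℝ := 3/2 * (2 - v) / ((2 - 4*v) * v) with hg
  have hgm : (2 - 4*v) * v * g = 3/2 * (2 - v) := by rw [hg]; field_simp
  have hg0 : 0 < g := by
    apply div_pos
    · linarith
    · positivity
  -- excluded band
  obtain ⟨T, hT0, hE⟩ : ∃ T ≤ 0, ∀ τ ≤ T, x τ ≤ v → O τ / r τ < g/2 ∨ g < O τ / r τ := by
    obtain ⟨T, hT⟩ := eventually_atBot.1 (hL.eventually
      (eventually_lt_atBot ((1 - mm v) * Real.log (g/2) + Real.log ((1 - v^2) / (3/4 + g)))))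
    refine ⟨min T 0, min_le_right _ _, fun τ hτ hxv => ?_⟩
    have hτ0 := hτ.trans (min_le_right _ _)
    by_contra! hc
    obtain ⟨hc1, hc2⟩ := hc
    have h1 := h.r_bound hτ0 (half_pos hg0) (hx τ hτ0).le hc1
    have h2 := hT τ (hτ.trans (min_le_left _ _))
    have hr := h.rpos τ hτ0
    rw [div_le_iff₀ hr] at hc2
    have h3 : (1 - v^2) / (3/4 + g) ≤ r τ := by
      rw [div_le_iff₀ (by positivity)]
      have := h.con τ hτ0
      have := hx τ hτ0
      nlinarith
    have h4 := Real.log_le_log (div_pos h.vsq (by positivity)) h3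
    linarith
  have hxc : ∀ τ ≤ 0, ContinuousAt x τ := fun τ hτ => (h.hx τ hτ).continuousAt
  have hRc : ∀ τ ≤ 0, ContinuousAt (fun t => O t / r t) τ := fun τ hτ => (h.hR τ hτ).continuousAt
  by_cases hi : ∃ τ0 ≤ T, x τ0 ≤ v ∧ O τ0 / r τ0 ≤ g/2
  · exfalso
    obtain ⟨τ0, hτ0, hx0, hR0⟩ := hi
    have hτ00 := hτ0.trans hT0
    have key : ∀ τ ≤ τ0, max (x τ - v) (O τ / r τ - g/2) ≤ 0 := by
      refine back_barrier (f := fun τ => max (x τ - v) (O τ / r τ - g/2)) ?_ ?_ ?_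
      · intro τ hτ
        have hτ' := (mem_Iic.1 hτ).trans hτ00
        have hcm : ContinuousAt (fun τ => max (x τ - v) (O τ / r τ - g/2)) τ :=
          Tendsto.max ((hxc τ hτ').sub continuousAt_const)
            ((hRc τ hτ').sub continuousAt_const)
        exact hcm.continuousWithinAt
      · exact max_le (by linarith) (by linarith)
      · intro t ht hft
        have ht0 := ht.trans hτ00
        have a1 : x t ≤ v := by linarith [(max_le_iff.1 hft).1]
        have a2 : O t / r t ≤ g/2 := by linarith [(max_le_iff.1 hft).2]
        have a3 : O t / r t < g/2 := by
          rcases hE t (ht.trans hτ0) a1 with h1 | h1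
          · exact h1
          · linarith
        have b1 : ∀ᶠ s in 𝓝[<] t, O s / r s < g/2 :=
          ((hRc t ht0).eventually (eventually_lt_nhds a3)).filter_mono nhdsWithin_le_nhds
        have b2 : ∀ᶠ s in 𝓝[<] t, x s ≤ v := by
          rcases a1.lt_or_eq with h1 | h1
          · exact (((hxc t ht0).eventually (eventually_lt_nhds h1)).filter_mono
              nhdsWithin_le_nhds).mono (fun s hs => hs.le)
          · have hr := h.rpos t ht0
            rw [div_lt_iff₀ hr] at a3
            have := left_lt (h.hx t ht0) (by
              rw [h1]
              have : (2 - 4*v) * v * O t ≤ (2 - 4*v) * v * (g/2 * r t) :=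
                mul_le_mul_of_nonneg_left a3.le (by positivity)
              nlinarith)
            rw [h1] at this
            exact this.mono (fun s hs => hs.le)
        filter_upwards [b1, b2] with s h1 h2
        exact max_le (by linarith) (by linarith)
    refine no_growth (f := x) (T := τ0) (B := 0)
      (δ := 3/4 * (2 - v) * ((1 - v^2) / (3/4 + g))) ?_ (fun τ hτ => h.hx τ (hτ.trans hτ00)) ?_
      (fun τ hτ => (hx τ (hτ.trans hτ00)).le)
    · have := h.vsq
      have : 0 < 2 - v := by linarith
      positivity
    · intro τ hτ
      have hk := max_le_iff.1 (key τ hτ)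
      have ht0 := hτ.trans hτ00
      have a1 : x τ ≤ v := by linarith [hk.1]
      have a2 : O τ / r τ ≤ g/2 := by linarith [hk.2]
      have hr := h.rpos τ ht0
      have hOn := h.Onn τ ht0
      have hxp := hx τ ht0
      rw [div_le_iff₀ hr] at a2
      have h3 : (1 - v^2) / (3/4 + g) ≤ r τ := by
        rw [div_le_iff₀ (by positivity)]
        have := h.con τ ht0
        nlinarith
      have h4 : (2 - 4*v) * O τ * x τ ≤ (2 - 4*v) * (g/2 * r τ) * v := by
        apply mul_le_mul _ a1 hxp.le
        · positivity
        · exact mul_le_mul_of_nonneg_left a2 hw.le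
      have h5 : (2 - 4*v) * (g/2 * r τ) * v = 3/4 * (2 - v) * r τ := by
        linear_combination (r τ / 2) * hgm
      have h6 : 3/4 * (2 - v) * ((1 - v^2) / (3/4 + g)) ≤ 3/4 * (2 - v) * r τ :=
        mul_le_mul_of_nonneg_left h3 (by linarith)
      nlinarith
  push Not at hi
  have hii : ∀ τ ≤ T, x τ ≤ v → g < O τ / r τ := by
    intro τ hτ hxv
    rcases hE τ hτ hxv with h1 | h1
    · linarith [hi τ hτ hxv]
    · exact h1
  by_cases hj : ∃ τ0 ≤ T, v ≤ x τ0
  · exfalso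
    obtain ⟨τ0, hτ0, hx0⟩ := hj
    have hτ00 := hτ0.trans hT0
    have key : ∀ τ ≤ τ0, v - x τ ≤ 0 := by
      refine back_barrier (f := fun τ => v - x τ) ?_ (by linarith) ?_
      · intro τ hτ
        have hτ' := (mem_Iic.1 hτ).trans hτ00
        exact (continuousAt_const.sub (hxc τ hτ')).continuousWithinAt
      · intro t ht hft
        have ht0 := ht.trans hτ00
        have a1 : v ≤ x t := by linarith
        rcases a1.lt_or_eq with h1 | h1
        · exact (((hxc t ht0).eventually (eventually_gt_nhds h1)).filter_mono
              nhdsWithin_le_nhds).mono (fun s hs => by linarith)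
        · have hr := h.rpos t ht0
          have a3 := hii t (ht.trans hτ0) h1.symm.le
          rw [lt_div_iff₀ hr] at a3
          have := left_lt ((h.hx t ht0).neg) (by
              rw [← h1]
              have : (2 - 4*v) * v * (g * r t) < (2 - 4*v) * v * O t :=
                mul_lt_mul_of_pos_left a3 (by positivity)
              nlinarith)
          refine this.mono (fun s hs => ?_)
          simp only [Pi.neg_apply] at hs
          linarith
    exact h.lemC hL hτ00 (fun τ hτ => by linarith [key τ hτ])
  push Not at hj
  have hr0 := h.r_zero hL hT0 hg0 (fun τ hτ => (hx τ (hτ.trans hT0)).le)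
    (fun τ hτ => (hii τ hτ (hj τ hτ).le).le)
  have hx0 : Tendsto x atBot (𝓝 0) := by
    rw [Metric.tendsto_nhds]
    intro e he
    -- small eta
    set η : ℝ := min (1/4) ((2 - 4*v) * e / 12) with hη
    have hη0 : 0 < η := by
      apply lt_min (by norm_num)
      positivity
    have hη1 : η ≤ 1/4 := min_le_left _ _
    have hη2 : η ≤ (2 - 4*v) * e / 12 := min_le_right _ _
    obtain ⟨T1, hT1⟩ := eventually_atBot.1 (hr0.eventually (eventually_lt_nhds hη0))
    have hder : ∀ τ ≤ min T T1, e ≤ x τ →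
        3/2 * r τ * (2 - x τ) - (2 - 4*v) * O τ * x τ ≤ - ((2 - 4*v) * e / 4) := by
      intro τ hτ hex
      have t1 := hτ.trans (min_le_left _ _)
      have t0 := t1.trans hT0
      have hr := h.rpos τ t0
      have hr1 := hT1 τ (hτ.trans (min_le_right _ _))
      have hc := h.con τ t0
      have hxv := hj τ t1
      have hO1 : 1/2 ≤ O τ := by
        have : x τ ^ 2 ≤ 1/4 := by nlinarith
        linarith
      have q1 : (2 - 4*v) * (1/2) * e ≤ (2 - 4*v) * O τ * x τ := by
        apply mul_le_mul _ hex he.le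
        · have : 0 ≤ O τ := by linarith
          positivity
        · exact mul_le_mul_of_nonneg_left hO1 hw.le
      have q2 : 3/2 * r τ * (2 - x τ) ≤ 3 * η := by nlinarith
      linarith
    filter_upwards [eventually_le_atBot (min T T1)] with τ0 hτ0
    rw [Real.dist_eq, sub_zero, abs_of_pos (hx τ0 ((hτ0.trans (min_le_left _ _)).trans hT0))]
    by_contra! hc
    have hτ00 := (hτ0.trans (min_le_left _ _)).trans hT0
    have key : ∀ τ ≤ τ0, e - x τ ≤ 0 := by
      refine back_barrier (f := fun τ => e - x τ) ?_ (by linarith) ?_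
      · intro τ hτ
        have hτ' := (mem_Iic.1 hτ).trans hτ00
        exact (continuousAt_const.sub (hxc τ hτ')).continuousWithinAt
      · intro t ht hft
        have ht0 := ht.trans hτ00
        have a1 : e ≤ x t := by linarith
        have a4 := hder t (ht.trans hτ0) a1
        have : 0 < (2 - 4*v) * e / 4 := by positivity
        have := left_lt ((h.hx t ht0).neg) (by linarith)
        refine this.mono (fun s hs => ?_)
        simp only [Pi.neg_apply] at hs
        linarith
    refine no_growth (f := fun τ => - x τ) (T := τ0) (B := -1) (δ := (2 - 4*v) * e / 4)
      (by positivity) (fun τ hτ => (h.hx τ (hτ.trans hτ00)).neg) ?_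
      (fun τ hτ => by linarith [(h.xbd (hτ.trans hτ00)).2])
    intro τ hτ
    have := hder τ (hτ.trans hτ0) (by linarith [key τ hτ])
    linarith
  refine ⟨?_, hx0, hr0⟩
  have hO : Tendsto O atBot (𝓝 (1 - 0^2 - 3/4 * 0)) := by
    refine Tendsto.congr' ?_ (((hx0.pow 2).const_sub 1).sub (hr0.const_mul (3/4)))
    filter_upwards [eventually_le_atBot 0] with τ hτ
    have h1 := h.con τ hτ
    linarith
  norm_num at hO
  exact hO

/-- the compact box containing the orbit -/
lemma bddG (h : Sys v x r O) {G : ℝ × ℝ × ℝ → ℝ}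
    (hG : ContinuousOn G (Icc (-1) 1 ×ˢ Icc 0 2 ×ˢ Icc 0 1)) :
    ∃ K, ∀ τ ≤ 0, |G (x τ, r τ, O τ)| ≤ K := by
  obtain ⟨K, hK⟩ := (isCompact_Icc.prod (isCompact_Icc.prod isCompact_Icc)).exists_bound_of_continuousOn hG
  refine ⟨K, fun τ hτ => ?_⟩
  have h1 := h.rpos τ hτ
  have h2 := h.Onn τ hτ
  have h3 := h.con τ hτ
  have h4 := h.xbd hτ
  exact hK _ ⟨⟨h4.1.le, h4.2.le⟩, ⟨h1.le, by dsimp only; nlinarith⟩, ⟨h2, by dsimp only; nlinarith⟩⟩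

/-- Lemma D -/
lemma lemD (h : Sys v x r O) (hOp : ∀ τ ≤ 0, 0 < O τ) {B : ℝ}
    (hB : ∀ τ ≤ 0, B ≤ LL v x r O τ) : ∀ τ ≤ 0, x τ = v ∧ O τ = 1 - v/2 := by
  have v0 := h.v0
  have v1 := h.v1
  have hvs := h.vsq
  have hA : 0 < 4*(1-2*v)/(1-v^2) := div_pos (by linarith) hvs
  have hv2 : 0 < 1 - 2*v := by linarith
  set A := 4*(1-2*v)/(1-v^2) with hAdef
  obtain ⟨l, hl, hle⟩ := conv_mono (h.hLL hOp)
    (fun τ hτ => by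
      have := h.vx_pos hτ
      positivity) hB
  -- first Barbalat step
  have hg0 : Tendsto (fun τ => A * (x τ - v)^2 / (1 - v * x τ)) atBot (𝓝 0) := by
    obtain ⟨K, hK⟩ := h.bddG (G := fun p =>
      (A * (2 * (p.1 - v) * (3/2 * p.2.1 * (2 - p.1) - (2 - 4*v) * p.2.2 * p.1)) * (1 - v * p.1)
       - A * (p.1 - v)^2 * (-(v * (3/2 * p.2.1 * (2 - p.1) - (2 - 4*v) * p.2.2 * p.1))))
        / (1 - v * p.1)^2) (by
      apply ContinuousOn.div
      · fun_prop
      · fun_prop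
      · rintro ⟨a, b, c⟩ ⟨⟨h1, h2⟩, -⟩
        dsimp only at h1 h2 ⊢
        have : 0 < 1 - v * a := by nlinarith
        positivity)
    refine barbalat (h.hLL hOp) (fun τ hτ => ?_) hK hl
    have h3 := (h.vx_pos hτ).ne'
    have hd := ((((h.hx τ hτ).sub_const v).pow 2).const_mul A).div
      (((h.hx τ hτ).const_mul v).const_sub 1) h3
    refine HasDerivAt.congr_deriv hd ?_
    simp only [Pi.pow_apply]
    norm_num
  have hxv : Tendsto x atBot (𝓝 v) := by
    have h1 : Tendsto (fun τ => (x τ - v)^2) atBot (𝓝 0) := by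
      have h2 : Tendsto (fun τ => (2 / A) * (A * (x τ - v)^2 / (1 - v * x τ))) atBot (𝓝 0) := by
        simpa using hg0.const_mul (2/A)
      refine tendsto_of_tendsto_of_tendsto_of_le_of_le' tendsto_const_nhds h2
        (Eventually.of_forall fun τ => sq_nonneg _) ?_
      filter_upwards [eventually_le_atBot 0] with τ hτ
      have h3 := h.vx_pos hτ
      have h4 := h.xbd hτ
      have h5 : 2 / A * (A * (x τ - v)^2 / (1 - v * x τ)) = 2 * (x τ - v)^2 / (1 - v * x τ) := by
        field_simp
      rw [h5, le_div_iff₀ h3]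
      have h6 : 1 - v * x τ ≤ 2 := by nlinarith
      nlinarith [sq_nonneg (x τ - v)]
    have h2 := sq_zero h1
    simpa using h2.add_const v
  -- second Barbalat step
  have hxd : Tendsto (fun τ => 3/2 * r τ * (2 - x τ) - (2 - 4*v) * O τ * x τ) atBot (𝓝 0) := by
    obtain ⟨K, hK⟩ := h.bddG (G := fun p =>
      (3/2 * ((8*v*p.2.2 + 4*p.1^2 - 8*p.1) * p.2.1)) * (2 - p.1)
      + 3/2 * p.2.1 * (-(3/2 * p.2.1 * (2 - p.1) - (2 - 4*v) * p.2.2 * p.1))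
      - ((2 - 4*v) * ((8*v*p.2.2 + 4*p.1^2 - 8*v) * p.2.2) * p.1
        + (2 - 4*v) * p.2.2 * (3/2 * p.2.1 * (2 - p.1) - (2 - 4*v) * p.2.2 * p.1)))
      (by fun_prop)
    refine barbalat h.hx (fun τ hτ => ?_) hK hxv
    exact (((h.hr τ hτ).const_mul (3/2)).mul ((h.hx τ hτ).const_sub 2)).sub
      (((h.hO τ hτ).const_mul (2 - 4*v)).mul (h.hx τ hτ))
  have hrl : Tendsto r atBot (𝓝 ((2 - 4*v) * v / 3)) := by
    have h1 : Tendsto (fun τ => ((3/2 * r τ * (2 - x τ) - (2 - 4*v) * O τ * x τ)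
        + (2 - 4*v) * (1 - x τ^2) * x τ) / (3 * (1 - v * x τ))) atBot
        (𝓝 ((0 + (2 - 4*v) * (1 - v^2) * v) / (3 * (1 - v * v)))) := by
      refine (hxd.add ((((hxv.pow 2).const_sub 1).const_mul (2 - 4*v)).mul hxv)).div
        (((hxv.const_mul v).const_sub 1).const_mul 3) ?_
      have : 1 - v * v = 1 - v^2 := by ring
      rw [this]; positivity
    have e : (0 + (2 - 4*v) * (1 - v^2) * v) / (3 * (1 - v * v)) = (2 - 4*v) * v / 3 := by
      have : 1 - v * v = 1 - v^2 := by ring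
      rw [this]
      field_simp
      ring
    rw [e] at h1
    refine h1.congr' ?_
    filter_upwards [eventually_le_atBot 0] with τ hτ
    have h3 := h.vx_pos hτ
    rw [div_eq_iff (by positivity)]
    have h4 : O τ = 1 - x τ^2 - 3/4 * r τ := by linarith [h.con τ hτ]
    rw [h4]
    ring
  have hOl : Tendsto O atBot (𝓝 (1 - v/2)) := by
    have h1 : Tendsto O atBot (𝓝 (1 - v^2 - 3/4 * ((2 - 4*v) * v / 3))) := by
      refine Tendsto.congr' ?_ (((hxv.pow 2).const_sub 1).sub (hrl.const_mul (3/4)))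
      filter_upwards [eventually_le_atBot 0] with τ hτ
      have h1 := h.con τ hτ
      linarith
    convert h1 using 2
    ring
  have hrs : 0 < (2 - 4*v) * v / 3 := by
    have : 0 < 2 - 4*v := by linarith
    positivity
  have hOs : 0 < 1 - v/2 := by linarith
  have hLs : Tendsto (LL v x r O) atBot (𝓝 (mm v * Real.log ((2 - 4*v) * v / 3)
      + (1 - mm v) * Real.log (1 - v/2) - 2 * Real.log (1 - v * v))) := by
    refine ((((hrl.log hrs.ne').const_mul _)).add ((hOl.log hOs.ne').const_mul _)).sub
      ((((hxv.const_mul v).const_sub 1).log ?_).const_mul 2)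
    have : 1 - v * v = 1 - v^2 := by ring
    rw [this]; exact hvs.ne'
  have hll := tendsto_nhds_unique hl hLs
  have m0 := h.mm_pos
  have m1 := h.mm_lt
  have mmul := h.mm_mul
  intro τ hτ
  have h1 := h.rpos τ hτ
  have h2 := hOp τ hτ
  have h3 := h.vx_pos hτ
  have hc := h.con τ hτ
  have hLle := hle τ hτ
  rw [hll] at hLle
  have e1 : 1 - v * v = 1 - v^2 := by ring
  rw [e1] at hLle
  have ers : (2 - 4*v) * v / 3 = 4/3 * (mm v * (1 - v^2)) := by rw [mmul]; ring
  have eos : 1 - v/2 = (1 - mm v) * (1 - v^2) := by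
    have : (1 - mm v) * (1 - v^2) = (1 - v^2) - mm v * (1 - v^2) := by ring
    rw [this, mmul]; ring
  have hs : 0 < 1 - x τ^2 := by linarith
  set rs := (2 - 4*v) * v / 3
  set os := 1 - v/2
  set s := (1 - x τ^2) / (1 - v^2) with hsd
  have hs0 : 0 < s := div_pos hs hvs
  set a := r τ / (rs * s) with ha
  set b := O τ / (os * s) with hb
  have ha0 : 0 < a := by positivity
  have hb0 : 0 < b := by positivity
  have hm' : 0 < 1 - mm v := by linarith
  have hab : mm v * a + (1 - mm v) * b = 1 := by
    rw [ha, hb, hsd, ers, eos]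
    field_simp
    linarith
  set w := (1 - x τ^2) * (1 - v^2) / (1 - v * x τ)^2 with hw
  have hw0 : 0 < w := by positivity
  have hla : Real.log a = Real.log (r τ) - (Real.log rs + Real.log s) := by
    rw [ha, Real.log_div h1.ne' (by positivity), Real.log_mul hrs.ne' hs0.ne']
  have hlb : Real.log b = Real.log (O τ) - (Real.log os + Real.log s) := by
    rw [hb, Real.log_div h2.ne' (by positivity), Real.log_mul hOs.ne' hs0.ne']
  have hls : Real.log s = Real.log (1 - x τ^2) - Real.log (1 - v^2) := by
    rw [hsd, Real.log_div hs.ne' hvs.ne']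
  have hlw : Real.log w = Real.log (1 - x τ^2) + Real.log (1 - v^2)
      - 2 * Real.log (1 - v * x τ) := by
    rw [hw, Real.log_div (by positivity) (by positivity), Real.log_mul hs.ne' hvs.ne',
      Real.log_pow]
    norm_num
  have hmain : 0 ≤ mm v * Real.log a + (1 - mm v) * Real.log b + Real.log w := by
    rw [hla, hlb, hlw]
    unfold LL at hLle
    have : mm v * (Real.log (r τ) - (Real.log rs + Real.log s))
        + (1 - mm v) * (Real.log (O τ) - (Real.log os + Real.log s))
        = mm v * Real.log (r τ) + (1 - mm v) * Real.log (O τ)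
          - mm v * Real.log rs - (1 - mm v) * Real.log os - Real.log s := by ring
    rw [this, hls]
    linarith
  have hla1 := Real.log_le_sub_one_of_pos ha0
  have hlb1 := Real.log_le_sub_one_of_pos hb0
  have hlw1 := Real.log_le_sub_one_of_pos hw0
  have hww : w = 1 - (x τ - v)^2 / (1 - v * x τ)^2 := by
    rw [hw, eq_sub_iff_add_eq, ← add_div, div_eq_one_iff_eq (by positivity)]
    ring
  have p1 := mul_le_mul_of_nonneg_left hla1 m0.le
  have p2 := mul_le_mul_of_nonneg_left hlb1 hm'.le
  have hxe : x τ = v := by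
    by_contra hne
    have : 0 < (x τ - v)^2 := by
      have : x τ - v ≠ 0 := sub_ne_zero.2 hne
      positivity
    have : 0 < (x τ - v)^2 / (1 - v * x τ)^2 := by positivity
    linarith
  refine ⟨hxe, ?_⟩
  have hb1 : b = 1 := by
    by_contra hne
    have h4 := Real.log_lt_sub_one_of_pos hb0 hne
    have h5 : w ≤ 1 := by
      rw [hww]
      have : 0 ≤ (x τ - v)^2 / (1 - v * x τ)^2 := by positivity
      linarith
    have p3 := mul_lt_mul_of_pos_left h4 hm'
    linarith
  have hs1 : s = 1 := by rw [hsd, hxe, div_self hvs.ne']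
  rw [hb, hs1, mul_one, div_eq_one_iff_eq hOs.ne'] at hb1
  exact hb1

/-- `Ω` is either identically zero or positive everywhere. -/
lemma O_dich (h : Sys v x r O) : (∀ τ ≤ 0, O τ = 0) ∨ (∀ τ ≤ 0, 0 < O τ) := by
  have v0 := h.v0
  have v1 := h.v1
  have hb : ∀ τ ≤ 0, -8 ≤ 8*v*O τ + 4*x τ^2 - 8*v ∧ 8*v*O τ + 4*x τ^2 - 8*v ≤ 8 := by
    intro τ hτ
    have h1 := h.rpos τ hτ
    have h2 := h.Onn τ hτ
    have h3 := h.con τ hτ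
    have h4 : O τ ≤ 1 := by nlinarith
    have h5 : x τ^2 ≤ 1 := by linarith
    have h6 : 0 ≤ x τ^2 := sq_nonneg _
    have h7 : 0 ≤ v * O τ := mul_nonneg v0.le h2
    have h8 : v * O τ ≤ 1/2 * 1 := mul_le_mul v1.le h4 h2 (by norm_num)
    constructor <;> linarith
  rcases (h.Onn 0 le_rfl).eq_or_lt with h0 | h0
  · left
    intro τ hτ
    have hm := mono_of (f := fun t => O t * Real.exp (8*t)) (T := 0)
      (fun t ht => (h.hO t ht).mul (((hasDerivAt_id t).const_mul 8).exp)) (by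
        intro t ht
        have h1 := (hb t ht).1
        have h2 := h.Onn t ht
        have h3 := Real.exp_pos (8 * t)
        have : 0 ≤ (8*v*O t + 4*x t^2 - 8*v + 8) * (O t * Real.exp (8*t)) :=
          mul_nonneg (by linarith) (by positivity)
        simp only [id]
        linarith)
    have := hm (mem_Iic.2 hτ) (mem_Iic.2 le_rfl) hτ
    simp only [← h0, zero_mul] at this
    have h3 := Real.exp_pos (8 * τ)
    have h2 := h.Onn τ hτ
    nlinarith
  · right
    intro τ hτ
    have hm := mono_of (f := fun t => -(O t * Real.exp (-8*t))) (T := 0)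
      (fun t ht => ((h.hO t ht).mul (((hasDerivAt_id t).const_mul (-8)).exp)).neg) (by
        intro t ht
        have h1 := (hb t ht).2
        have h2 := h.Onn t ht
        have h3 := Real.exp_pos (-8 * t)
        have : 0 ≤ (8 - (8*v*O t + 4*x t^2 - 8*v)) * (O t * Real.exp (-8*t)) :=
          mul_nonneg (by linarith) (by positivity)
        simp only [id]
        linarith)
    have := hm (mem_Iic.2 hτ) (mem_Iic.2 le_rfl) hτ
    simp only [mul_zero, Real.exp_zero, mul_one] at this
    have h3 := Real.exp_pos (-8 * τ)
    have h2 := h.Onn τ hτ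
    by_contra! hc
    nlinarith

theorem main (h : Sys v x r O) :
    (∀ τ ≤ 0, x τ = v ∧ O τ = 1 - v/2) ∨
    (Tendsto O atBot (𝓝 1) ∧ Tendsto x atBot (𝓝 0) ∧ Tendsto r atBot (𝓝 0)) ∨
    (Tendsto O atBot (𝓝 0) ∧ Tendsto x atBot (𝓝 (-1)) ∧ Tendsto r atBot (𝓝 0)) := by
  rcases h.O_dich with h0 | hOp
  · right; right
    apply h.lemA
    refine tendsto_const_nhds.congr' ?_
    filter_upwards [eventually_le_atBot 0] with τ hτ
    rw [h0 τ hτ, zero_div]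
  by_cases hx : ∃ τ0 ≤ 0, x τ0 ≤ 0
  · obtain ⟨τ0, h1, h2⟩ := hx
    right
    exact h.lemB h1 h2
  push Not at hx
  by_cases hB : ∃ B, ∀ τ ≤ 0, B ≤ LL v x r O τ
  · obtain ⟨B, hB⟩ := hB
    left
    exact h.lemD hOp hB
  right; left
  push Not at hB
  refine h.lemE ?_ hx
  have v1 := h.v1
  have hvs := h.vsq
  have hm := mono_of (h.hLL hOp) (fun τ hτ => by
      have h1 := h.vx_pos hτ
      have h2 : 0 < 1 - 2*v := by linarith
      positivity)
  rw [tendsto_atBot]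
  intro B
  obtain ⟨T, hT, hTB⟩ := hB B
  filter_upwards [eventually_le_atBot T] with τ hτ
  exact (hm (mem_Iic.2 (hτ.trans hT)) (mem_Iic.2 hT) hτ).trans hTB.le

end Sys

/-- The reduced type II system, with `x = Σ₊`, `y = Σ₋`, `r = N₁²`, `v = (3γ-2)/8`. -/
structure Sys2 (v : ℝ) (x y r O : ℝ → ℝ) : Prop where
  v0 : 0 < v
  v1 : v < 1/2
  hx : ∀ τ ≤ 0, HasDerivAt x (3/2 * r τ * (2 - x τ) - (2 - 4*v) * O τ * x τ) τ
  hy : ∀ τ ≤ 0, HasDerivAt y (-((2 - 4*v) * O τ + 3/2 * r τ) * y τ) τ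
  hr : ∀ τ ≤ 0, HasDerivAt r (2 * (2 - ((2 - 4*v) * O τ + 3/2 * r τ) - 4*x τ) * r τ) τ
  hO : ∀ τ ≤ 0, HasDerivAt O ((4 - 2 * ((2 - 4*v) * O τ + 3/2 * r τ) - 8*v) * O τ) τ
  rpos : ∀ τ ≤ 0, 0 < r τ
  Onn : ∀ τ ≤ 0, 0 ≤ O τ
  con : ∀ τ ≤ 0, O τ + x τ^2 + y τ^2 + 3/4 * r τ = 1

namespace Sys2
variable {v : ℝ} {x y r O : ℝ → ℝ}

lemma xbd (h : Sys2 v x y r O) {τ : ℝ} (hτ : τ ≤ 0) : -1 < x τ ∧ x τ < 1 := by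
  have h1 := h.rpos τ hτ
  have h2 := h.Onn τ hτ
  have h3 := h.con τ hτ
  constructor <;> nlinarith [sq_nonneg (y τ)]

lemma ybd (h : Sys2 v x y r O) {τ : ℝ} (hτ : τ ≤ 0) : -1 < y τ ∧ y τ < 1 := by
  have h1 := h.rpos τ hτ
  have h2 := h.Onn τ hτ
  have h3 := h.con τ hτ
  constructor <;> nlinarith [sq_nonneg (x τ)]

lemma Qnn (h : Sys2 v x y r O) {τ : ℝ} (hτ : τ ≤ 0) :
    0 ≤ (2 - 4*v) * O τ + 3/2 * r τ := by
  have h1 := h.rpos τ hτ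
  have h2 := mul_nonneg (show 0 ≤ 2 - 4*v by linarith [h.v1]) (h.Onn τ hτ)
  linarith

lemma hy2 (h : Sys2 v x y r O) : ∀ τ ≤ 0,
    HasDerivAt (fun t => y t ^ 2) (-2 * ((2 - 4*v) * O τ + 3/2 * r τ) * y τ^2) τ := by
  intro τ hτ
  refine HasDerivAt.congr_deriv ((h.hy τ hτ).pow 2) ?_
  norm_num
  ring

lemma y2ge (h : Sys2 v x y r O) : ∀ τ ≤ 0, y 0 ^ 2 ≤ y τ ^ 2 := by
  intro τ hτ
  have hm := mono_of (f := fun t => -(y t ^ 2)) (T := 0) (fun t ht => (h.hy2 t ht).neg) (by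
    intro t ht
    have := mul_nonneg (h.Qnn ht) (sq_nonneg (y t))
    linarith)
  have := hm (mem_Iic.2 hτ) (mem_Iic.2 le_rfl) hτ
  simpa using this

lemma y2conv (h : Sys2 v x y r O) : ∃ l, Tendsto (fun t => y t ^ 2) atBot (𝓝 l) := by
  obtain ⟨l, hl, -⟩ := conv_mono (f := fun t => -(y t ^ 2)) (T := 0) (B := -1)
    (fun t ht => (h.hy2 t ht).neg) (by
    intro t ht
    have := mul_nonneg (h.Qnn ht) (sq_nonneg (y t))
    linarith) (by
    intro t ht
    have := h.ybd ht
    nlinarith)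
  refine ⟨-l, ?_⟩
  simpa using hl.neg

lemma fconv (h : Sys2 v x y r O) (hy0 : y 0 ≠ 0) {f f' : ℝ → ℝ} {C B : ℝ} (hC : 0 ≤ C)
    (hd : ∀ τ ≤ 0, HasDerivAt f (f' τ) τ)
    (hf' : ∀ τ ≤ 0, f' τ ≤ C * ((2 - 4*v) * O τ + 3/2 * r τ))
    (hB : ∀ τ ≤ 0, f τ ≤ B) : ∃ l, Tendsto f atBot (𝓝 l) := by
  have hD : 0 < y 0 ^ 2 := by positivity
  set D := y 0 ^ 2
  obtain ⟨β, hβ⟩ := h.y2conv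
  obtain ⟨l, hl, -⟩ := conv_mono (f := fun t => -(f t + C / (2 * D) * y t ^ 2)) (T := 0)
    (B := -(B + C / (2 * D)))
    (fun t ht => ((hd t ht).add ((h.hy2 t ht).const_mul (C / (2 * D)))).neg) (by
      intro t ht
      have h1 := hf' t ht
      have h2 := h.Qnn ht
      have h3 : D ≤ y t ^ 2 := h.y2ge t ht
      have h4 : C * ((2 - 4*v) * O t + 3/2 * r t)
          ≤ C / (2 * D) * (2 * ((2 - 4*v) * O t + 3/2 * r t) * y t^2) := by
        have e : C / (2 * D) * (2 * ((2 - 4*v) * O t + 3/2 * r t) * y t^2)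
          = C * ((2 - 4*v) * O t + 3/2 * r t) * (y t^2 / D) := by field_simp
        rw [e]
        apply le_mul_of_one_le_right (mul_nonneg hC h2)
        rw [one_le_div hD]; exact h3
      linarith) (by
      intro t ht
      have h1 := hB t ht
      have h2 := h.ybd ht
      have h3 : y t ^ 2 ≤ 1 := by nlinarith
      have h4 : C / (2 * D) * y t ^ 2 ≤ C / (2 * D) :=
        mul_le_of_le_one_right (by positivity) h3
      linarith)
  refine ⟨-l - C / (2 * D) * β, ?_⟩
  refine (hl.neg.sub (hβ.const_mul (C / (2 * D)))).congr ?_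
  intro t
  ring

lemma hR (h : Sys2 v x y r O) : ∀ τ ≤ 0,
    HasDerivAt (fun t => O t / r t) (8 * (x τ - v) * (O τ / r τ)) τ := by
  intro τ hτ
  have h1 := (h.rpos τ hτ).ne'
  refine ((h.hO τ hτ).div (h.hr τ hτ) h1).congr_deriv ?_
  field_simp
  ring

theorem main (h : Sys2 v x y r O) (hy0 : y 0 ≠ 0) :
    ∃ a b : ℝ, a^2 + b^2 = 1 ∧ b ≠ 0 ∧ a < 1/2 ∧
      Tendsto O atBot (𝓝 0) ∧ Tendsto x atBot (𝓝 a) ∧ Tendsto y atBot (𝓝 b) ∧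
      Tendsto r atBot (𝓝 0) := by
  have v0 := h.v0
  have v1 := h.v1
  have hw : 0 < 2 - 4*v := by linarith
  obtain ⟨a, ha⟩ := h.fconv hy0 (C := 3) (B := 1) (by norm_num) h.hx (by
    intro τ hτ
    have h1 := h.rpos τ hτ
    have h2 := mul_nonneg hw.le (h.Onn τ hτ)
    have h3 := h.xbd hτ
    nlinarith) (fun τ hτ => (h.xbd hτ).2.le)
  obtain ⟨b, hb⟩ := h.fconv hy0 (C := 1) (B := 1) (by norm_num) h.hy (by
    intro τ hτ
    have h1 := h.Qnn hτ
    have h3 := h.ybd hτ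
    nlinarith) (fun τ hτ => (h.ybd hτ).2.le)
  obtain ⟨o, ho⟩ := h.fconv hy0 (C := 4 / (2 - 4*v)) (B := 1) (by positivity) h.hO (by
    intro τ hτ
    have h1 := h.rpos τ hτ
    have h2 := h.Onn τ hτ
    have h3 := h.Qnn hτ
    have e1 : (4 - 2 * ((2 - 4*v) * O τ + 3/2 * r τ) - 8*v) * O τ ≤ 4 * O τ :=
      mul_le_mul_of_nonneg_right (by linarith) h2
    have e2 : 4 / (2 - 4*v) * ((2 - 4*v) * O τ) = 4 * O τ := by field_simp
    have e3 : 0 ≤ 4 / (2 - 4*v) * (3/2 * r τ) := by positivity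
    rw [mul_add (4 / (2 - 4*v)), e2]
    linarith) (fun τ hτ => by
      have h1 := h.rpos τ hτ
      have h3 := h.con τ hτ
      nlinarith [sq_nonneg (x τ), sq_nonneg (y τ)])
  obtain ⟨ρ, hρ⟩ := h.fconv hy0 (C := 8) (B := 2) (by norm_num) h.hr (by
    intro τ hτ
    have h1 := h.rpos τ hτ
    have h2 := mul_nonneg hw.le (h.Onn τ hτ)
    have h3 := h.xbd hτ
    have h4 := h.Qnn hτ
    have e1 : 2 * (2 - ((2 - 4*v) * O τ + 3/2 * r τ) - 4*x τ) * r τ ≤ 12 * r τ :=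
      mul_le_mul_of_nonneg_right (by linarith) h1.le
    linarith) (fun τ hτ => by
      have h1 := h.Onn τ hτ
      have h3 := h.con τ hτ
      nlinarith [sq_nonneg (x τ), sq_nonneg (y τ)])
  have hb2 : y 0 ^ 2 ≤ b^2 := ge_of_tendsto (hb.pow 2) (by
    filter_upwards [eventually_le_atBot 0] with τ hτ using h.y2ge τ hτ)
  have hb0 : 0 < b^2 := lt_of_lt_of_le (by positivity) hb2
  have hbne : b ≠ 0 := by
    rintro rfl
    norm_num at hb0
  have ho0 : 0 ≤ o := ge_of_tendsto ho (by
    filter_upwards [eventually_le_atBot 0] with τ hτ using h.Onn τ hτ)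
  have hρ0 : 0 ≤ ρ := ge_of_tendsto hρ (by
    filter_upwards [eventually_le_atBot 0] with τ hτ using (h.rpos τ hτ).le)
  have hQ : Tendsto (fun τ => (2 - 4*v) * O τ + 3/2 * r τ) atBot
      (𝓝 ((2 - 4*v) * o + 3/2 * ρ)) := (ho.const_mul _).add (hρ.const_mul _)
  have hz := deriv_lim_zero h.hy2 (hb.pow 2) ((hQ.const_mul (-2)).mul (hb.pow 2))
  have hQ0 : (2 - 4*v) * o + 3/2 * ρ = 0 := by
    rcases mul_eq_zero.1 hz with h1 | h1
    · linarith
    · exact absurd h1 hb0.ne'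
  have hwo := mul_nonneg hw.le ho0
  have hρz : ρ = 0 := by linarith
  have hoz : o = 0 := by
    have : (2 - 4*v) * o = 0 := by linarith
    rcases mul_eq_zero.1 this with h1 | h1
    · linarith
    · exact h1
  subst hρz hoz
  have hab : a^2 + b^2 = 1 := by
    have h1 : Tendsto (fun τ => O τ + x τ^2 + y τ^2 + 3/4 * r τ) atBot
      (𝓝 (0 + a^2 + b^2 + 3/4 * 0)) := ((ho.add (ha.pow 2)).add (hb.pow 2)).add (hρ.const_mul _)
    have h2 : Tendsto (fun τ => O τ + x τ^2 + y τ^2 + 3/4 * r τ) atBot (𝓝 1) := by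
      refine tendsto_const_nhds.congr' ?_
      filter_upwards [eventually_le_atBot 0] with τ hτ using (h.con τ hτ).symm
    have := tendsto_nhds_unique h1 h2
    linarith
  refine ⟨a, b, hab, hbne, ?_, ho, ha, hb, hρ⟩
  by_contra! hc
  obtain ⟨T1, hT1⟩ := eventually_atBot.1 (ha.eventually (eventually_gt_nhds
    (show v < a by linarith)))
  obtain ⟨ρ', hρ', -⟩ := conv_mono (f := fun t => O t / r t) (T := min T1 0) (B := 0)
    (fun τ hτ => h.hR τ (hτ.trans (min_le_right _ _)))
    (fun τ hτ => mul_nonneg (by linarith [hT1 τ (hτ.trans (min_le_left _ _))])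
      (div_nonneg (h.Onn τ (hτ.trans (min_le_right _ _)))
        (h.rpos τ (hτ.trans (min_le_right _ _))).le))
    (fun τ hτ => div_nonneg (h.Onn τ (hτ.trans (min_le_right _ _)))
        (h.rpos τ (hτ.trans (min_le_right _ _))).le)
  have hz2 := deriv_lim_zero h.hR hρ' (((ha.sub_const v).const_mul 8).mul hρ')
  have hρ'0 : ρ' = 0 := by
    rcases mul_eq_zero.1 hz2 with h1 | h1
    · linarith
    · exact h1
  subst hρ'0
  obtain ⟨T2, hT2⟩ := eventually_atBot.1 (hρ'.eventually (eventually_lt_nhds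
    (show (0:ℝ) < 1/2 by norm_num)))
  set T := min T2 0
  have hT0 : T ≤ 0 := min_le_right _ _
  have hT : ∀ τ ≤ T, O τ ≤ 1/2 * r τ := by
    intro τ hτ
    have h1 := hT2 τ (hτ.trans (min_le_left _ _))
    rw [div_lt_iff₀ (h.rpos τ (hτ.trans hT0))] at h1
    exact h1.le
  obtain ⟨a', ha', hax⟩ := conv_mono (f := x) (T := T) (B := -1)
    (fun τ hτ => h.hx τ (hτ.trans hT0))
    (by
      intro τ hτ
      have h1 := hT τ hτ
      obtain ⟨h2, h3⟩ := h.xbd (hτ.trans hT0)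
      have h4 := h.rpos τ (hτ.trans hT0)
      have h5 := h.Onn τ (hτ.trans hT0)
      have h6 : (2 - 4*v) * O τ * x τ ≤ 2 * (1/2 * r τ) := by
        have e1 : (2 - 4*v) * O τ ≤ 2 * (1/2 * r τ) := by nlinarith
        have e2 : 0 ≤ (2 - 4*v) * O τ := mul_nonneg (by linarith) h5
        nlinarith
      nlinarith)
    (fun τ hτ => (h.xbd (hτ.trans hT0)).1.le)
  have haa := tendsto_nhds_unique ha' ha
  refine no_decay (f := r) (T := T) (fun τ hτ => h.hr τ (hτ.trans hT0)) ?_ (h.rpos T hT0) hρ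
  intro τ hτ
  have h1 := hax τ hτ
  have h2 := h.Qnn (hτ.trans hT0)
  have h3 := h.rpos τ (hτ.trans hT0)
  apply mul_nonpos_of_nonpos_of_nonneg _ h3.le
  linarith

end Sys2

lemma kasner_arc {a b : ℝ} (hab : a^2 + b^2 = 1) (hb : b ≠ 0) (ha : a < 1/2) :
    a + Real.sqrt 3 * b < -1 ∨ a - Real.sqrt 3 * b < -1 := by
  have hs : Real.sqrt 3 ^ 2 = 3 := Real.sq_sqrt (by norm_num)
  have hs0 : 0 ≤ Real.sqrt 3 := Real.sqrt_nonneg 3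
  have hb2 : 0 < b^2 := by positivity
  have ha1 : 0 < 1 + a := by nlinarith
  have key : ∀ t : ℝ, t^2 = b^2 → 0 ≤ t → a - Real.sqrt 3 * t < -1 := by
    intro t ht ht0
    by_contra! hc
    have h1 : Real.sqrt 3 * t ≤ 1 + a := by linarith
    have h2 : (Real.sqrt 3 * t)^2 ≤ (1 + a)^2 := pow_le_pow_left₀ (by positivity) h1 2
    rw [mul_pow, hs, ht] at h2
    nlinarith
  rcases le_total 0 b with h | h
  · right; exact key b rfl h
  · left
    have := key (-b) (by ring) (by linarith)
    linarith

lemma toSys2 {γ : ℝ} (hγ1 : 2/3 < γ) (hγ2 : γ < 2)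
    {O Sp Sm n1 n2 n3 : ℝ → ℝ}
    (hsol : SolOn γ (Set.Iic 0) O Sp Sm n1 n2 n3)
    (hn1 : ∀ τ ∈ Set.Iic (0:ℝ), 0 < n1 τ)
    (hn2 : ∀ τ ∈ Set.Iic (0:ℝ), n2 τ = 0)
    (hn3 : ∀ τ ∈ Set.Iic (0:ℝ), n3 τ = 0) :
    Sys2 ((3*γ - 2)/8) Sp Sm (fun t => n1 t ^ 2) O := by
  have con : ∀ τ ≤ 0, O τ + Sp τ^2 + Sm τ^2 + 3/4 * n1 τ^2 = 1 := by
    intro τ hτ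
    have := hsol.hcon τ hτ
    unfold Constraint at this
    rw [hn2 τ hτ, hn3 τ hτ] at this
    linarith
  have hq : ∀ τ ≤ 0, qf γ (O τ) (Sp τ) (Sm τ)
      = 2 - ((2 - 4*((3*γ - 2)/8)) * O τ + 3/2 * n1 τ^2) := by
    intro τ hτ
    unfold qf
    linear_combination 2 * con τ hτ
  refine ⟨by linarith, by linarith, ?_, ?_, ?_, ?_, ?_, hsol.hOnn, con⟩
  · intro τ hτ
    refine (hsol.hSp τ hτ).congr_deriv ?_
    rw [hq τ hτ, hn2 τ hτ, hn3 τ hτ]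
    unfold SPf
    ring
  · intro τ hτ
    refine (hsol.hSm τ hτ).congr_deriv ?_
    rw [hq τ hτ, hn2 τ hτ, hn3 τ hτ]
    unfold SMf
    ring
  · intro τ hτ
    refine HasDerivAt.congr_deriv ((hsol.hn1 τ hτ).pow 2) ?_
    rw [hq τ hτ]
    norm_num
    ring
  · intro τ hτ
    refine (hsol.hO τ hτ).congr_deriv ?_
    rw [hq τ hτ]
    ring
  · intro τ hτ
    have := hn1 τ hτ
    positivity

lemma Sys2.toSys {v : ℝ} {x y r O : ℝ → ℝ} (h : Sys2 v x y r O) (hy : ∀ τ ≤ 0, y τ = 0) :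
    Sys v x r O := by
  have con : ∀ τ ≤ 0, O τ + x τ^2 + 3/4 * r τ = 1 := by
    intro τ hτ
    have := h.con τ hτ
    rw [hy τ hτ] at this
    linarith
  refine ⟨h.v0, h.v1, h.hx, ?_, ?_, h.rpos, h.Onn, con⟩
  · intro τ hτ
    refine (h.hr τ hτ).congr_deriv ?_
    linear_combination (-4 * r τ) * con τ hτ
  · intro τ hτ
    refine (h.hO τ hτ).congr_deriv ?_
    linear_combination (-4 * O τ) * con τ hτ

/-- asymptotics of type II solutions with `N₁ > 0`, `N₂ = N₃ = 0` and
`2/3 < γ < 2`; if `Σ₋(0) ≠ 0` the α-limit set is a point of `K₂ ∪ K₃`, and if `Σ₋ ≡ 0`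
then exactly one of the three stated alternatives holds. -/
theorem typeII_asymptotics
    (γ : ℝ) (hγ1 : 2/3 < γ) (hγ2 : γ < 2)
    (O Sp Sm n1 n2 n3 : ℝ → ℝ)
    (hsol : SolOn γ (Set.Iic 0) O Sp Sm n1 n2 n3)
    (hn1 : ∀ τ ∈ Set.Iic (0:ℝ), 0 < n1 τ)
    (hn2 : ∀ τ ∈ Set.Iic (0:ℝ), n2 τ = 0)
    (hn3 : ∀ τ ∈ Set.Iic (0:ℝ), n3 τ = 0) :
    (Sm 0 ≠ 0 →
      ∃ a b : ℝ, a^2 + b^2 = 1 ∧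
        (a + Real.sqrt 3 * b < -1 ∨ a - Real.sqrt 3 * b < -1) ∧
        Tendsto O atBot (𝓝 0) ∧ Tendsto Sp atBot (𝓝 a) ∧ Tendsto Sm atBot (𝓝 b) ∧
        Tendsto n1 atBot (𝓝 0)) ∧
    ((∀ τ ∈ Set.Iic (0:ℝ), Sm τ = 0) →
      ((IsFixedP1 γ (Set.Iic 0) O Sp Sm n1 n2 n3 ∧
          ¬ TendstoF O Sp Sm n1 n2 n3 ∧
          ¬ (Tendsto O atBot (𝓝 0) ∧ Tendsto Sp atBot (𝓝 (-1)) ∧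
              Tendsto n1 atBot (𝓝 0))) ∨
       (¬ IsFixedP1 γ (Set.Iic 0) O Sp Sm n1 n2 n3 ∧
          TendstoF O Sp Sm n1 n2 n3 ∧
          ¬ (Tendsto O atBot (𝓝 0) ∧ Tendsto Sp atBot (𝓝 (-1)) ∧
              Tendsto n1 atBot (𝓝 0))) ∨
       (¬ IsFixedP1 γ (Set.Iic 0) O Sp Sm n1 n2 n3 ∧
          ¬ TendstoF O Sp Sm n1 n2 n3 ∧
          (Tendsto O atBot (𝓝 0) ∧ Tendsto Sp atBot (𝓝 (-1)) ∧
              Tendsto n1 atBot (𝓝 0))))) := by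
  have h2 := toSys2 hγ1 hγ2 hsol hn1 hn2 hn3
  refine ⟨fun hy0 => ?_, fun hy => ?_⟩
  · obtain ⟨a, b, hab, hb, ha, hO, hx, hy, hr⟩ := h2.main hy0
    exact ⟨a, b, hab, kasner_arc hab hb ha, hO, hx, hy, sq_zero hr⟩
  have zero_of : ∀ f : ℝ → ℝ, (∀ τ ∈ Set.Iic (0:ℝ), f τ = 0) → Tendsto f atBot (𝓝 0) := by
    intro f hf
    refine tendsto_const_nhds.congr' ?_
    filter_upwards [eventually_le_atBot 0] with τ hτ using (hf τ hτ).symm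
  have hP : IsFixedP1 γ (Set.Iic 0) O Sp Sm n1 n2 n3 →
      Tendsto O atBot (𝓝 (1 - (3*γ - 2)/16)) := by
    intro hP
    refine tendsto_const_nhds.congr' ?_
    filter_upwards [eventually_le_atBot 0] with τ hτ using (hP τ hτ).1.symm
  have hPF : IsFixedP1 γ (Set.Iic 0) O Sp Sm n1 n2 n3 → ¬ TendstoF O Sp Sm n1 n2 n3 := by
    intro h1 h3
    have := tendsto_nhds_unique (hP h1) h3.1
    linarith
  have hPK : IsFixedP1 γ (Set.Iic 0) O Sp Sm n1 n2 n3 → ¬ (Tendsto O atBot (𝓝 0) ∧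
      Tendsto Sp atBot (𝓝 (-1)) ∧ Tendsto n1 atBot (𝓝 0)) := by
    intro h1 h3
    have := tendsto_nhds_unique (hP h1) h3.1
    linarith
  have hFK : TendstoF O Sp Sm n1 n2 n3 → ¬ (Tendsto O atBot (𝓝 0) ∧
      Tendsto Sp atBot (𝓝 (-1)) ∧ Tendsto n1 atBot (𝓝 0)) := by
    intro h1 h3
    have := tendsto_nhds_unique h1.1 h3.1
    linarith
  rcases (h2.toSys hy).main with h | ⟨hO, hx, hr⟩ | ⟨hO, hx, hr⟩
  · have h1 : IsFixedP1 γ (Set.Iic 0) O Sp Sm n1 n2 n3 := by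
      intro τ hτ
      obtain ⟨e1, e2⟩ := h τ hτ
      exact ⟨by rw [e2]; ring, e1, hy τ hτ, hn1 τ hτ, hn2 τ hτ, hn3 τ hτ⟩
    exact Or.inl ⟨h1, hPF h1, hPK h1⟩
  · have h1 : TendstoF O Sp Sm n1 n2 n3 :=
      ⟨hO, hx, zero_of _ hy, sq_zero hr, zero_of _ hn2, zero_of _ hn3⟩
    exact Or.inr (Or.inl ⟨fun h3 => hPF h3 h1, h1, hFK h1⟩)
  · have h1 : Tendsto O atBot (𝓝 0) ∧ Tendsto Sp atBot (𝓝 (-1)) ∧ Tendsto n1 atBot (𝓝 0) :=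
      ⟨hO, hx, sq_zero hr⟩
    exact Or.inr (Or.inr ⟨fun h3 => hPK h3 h1, fun h3 => hFK h3 h1, h1⟩)

end WainwrightHsu
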